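/- Let 1 < p < n, q = p/(p-1), and let f be a smooth compactly supported function on ℝ^n, not identically zero on ℝ^n_+. Then the central slice K_{f,0} of the body K_f satisfies K_{f,0} = ((n+p-1) a_{n-1,p} vol(L_f))^{1/p} q^{1/q} p^{1/p} · Γ_p L_f, and consequently vol(K_{f,0}) = (p q^{p/q} (n+p-1) a_{n-1,p})^{(n-1)/p} vol(L_f)^{(n-1)/p} vol(Γ_p L_f). -/

import Mathlib

open MeasureTheory Real Set
open scoped RealInnerProductSpace ENNReal NNReal Pointwise

noncomputable section

namespace AffineTrace

/-- `ω s = π^(s/2) / Γ(s/2 + 1)` -/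
def w (s : ℝ) : ℝ := Real.pi ^ (s / 2) / Real.Gamma (s / 2 + 1)

/-- the constant `c_{m,p} = (m ω_m)^{1/m} (m ω_m ω_{p-1} / (2 ω_{m+p-2}))^{1/p}` -/
def cc (m : ℕ) (p : ℝ) : ℝ :=
  ((m : ℝ) * w m) ^ ((m : ℝ)⁻¹) *
    ((m : ℝ) * w m * w (p - 1) / (2 * w ((m : ℝ) + p - 2))) ^ p⁻¹

/-- the constant `a_{m,p} = ω_{m+p} / (ω_2 ω_m ω_{p-1})` -/
def aa (m : ℕ) (p : ℝ) : ℝ := w ((m : ℝ) + p) / (w 2 * w m * w (p - 1))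

/-- the open half-space `ℝⁿ₊ = (0,∞) × ℝ^{n-1}` -/
def H (n : ℕ) : Set (ℝ × EuclideanSpace ℝ (Fin (n - 1))) := {y | 0 < y.1}

/-- `∂f/∂t`, the partial derivative in the `t`-variable -/
def dt {n : ℕ} (f : ℝ × EuclideanSpace ℝ (Fin (n - 1)) → ℝ)
    (y : ℝ × EuclideanSpace ℝ (Fin (n - 1))) : ℝ :=
  fderiv ℝ f y (1, 0)

/-- `∇_ξ f = ∇̃f ⬝ ξ`, the directional derivative in the direction `(0, ξ)` -/
def dxi {n : ℕ} (f : ℝ × EuclideanSpace ℝ (Fin (n - 1)) → ℝ)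
    (ξ : EuclideanSpace ℝ (Fin (n - 1))) (y : ℝ × EuclideanSpace ℝ (Fin (n - 1))) : ℝ :=
  fderiv ℝ f y (0, ξ)

/-- `∇̃f`, the gradient in the `x`-variable -/
def gradx {n : ℕ} (f : ℝ × EuclideanSpace ℝ (Fin (n - 1)) → ℝ)
    (y : ℝ × EuclideanSpace ℝ (Fin (n - 1))) : EuclideanSpace ℝ (Fin (n - 1)) :=
  gradient (fun x => f (y.1, x)) y.2

/-- the `L^p` norm (w.r.t. Lebesgue measure) over the half-space `ℝⁿ₊` -/
def lp (n : ℕ) (p : ℝ) (g : ℝ × EuclideanSpace ℝ (Fin (n - 1)) → ℝ) : ℝ :=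
  (∫ y in H n, |g y| ^ p) ^ p⁻¹

/-- the surface measure on the unit sphere `𝕊^{m-1}` of `ℝ^m` -/
def sphMeasure (m : ℕ) : Measure (Metric.sphere (0 : EuclideanSpace ℝ (Fin m)) 1) :=
  (volume : Measure (EuclideanSpace ℝ (Fin m))).toSphere

/-- `Z_p(f) = (∫_{𝕊^{n-2}} ‖∇_ξ f‖_p^{1-n} dξ)^{1/(1-n)}` -/
def Z (n : ℕ) (p : ℝ) (f : ℝ × EuclideanSpace ℝ (Fin (n - 1)) → ℝ) : ℝ :=
  (∫ ξ, lp n p (dxi f (ξ : EuclideanSpace ℝ (Fin (n - 1)))) ^ (1 - (n : ℝ))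
      ∂(sphMeasure (n - 1))) ^ (1 - (n : ℝ))⁻¹

/-- the affine energy `ℰ_p(f) = c_{n-1,p} Z_p(f)` -/
def Ep (n : ℕ) (p : ℝ) (f : ℝ × EuclideanSpace ℝ (Fin (n - 1)) → ℝ) : ℝ :=
  cc (n - 1) p * Z n p f

/-- the boundary trace integral `∫_{∂ℝⁿ₊} |f(0,x)|^r dx` -/
def bdry (n : ℕ) (r : ℝ) (f : ℝ × EuclideanSpace ℝ (Fin (n - 1)) → ℝ) : ℝ :=
  ∫ x : EuclideanSpace ℝ (Fin (n - 1)), |f (0, x)| ^ r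

/-- the duality pairing on `ℝ × ℝ^m` -/
def pairP {m : ℕ} (y z : ℝ × EuclideanSpace ℝ (Fin m)) : ℝ := y.1 * z.1 + ⟪y.2, z.2⟫

/-- the Legendre transform of a function on `ℝ × ℝ^m` -/
def legendreP {m : ℕ} (C : ℝ × EuclideanSpace ℝ (Fin m) → ℝ)
    (y : ℝ × EuclideanSpace ℝ (Fin m)) : ℝ :=
  ⨆ z, (pairP y z - C z)

/-- the Legendre transform of a function on `ℝ^m` -/
def legendreE {m : ℕ} (C : EuclideanSpace ℝ (Fin m) → ℝ) (y : EuclideanSpace ℝ (Fin m)) : ℝ :=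
  ⨆ z, (⟪y, z⟫ - C z)

/-- the `m`-dimensional volume of a subset of `ℝ^m`, as a real number -/
def vol {m : ℕ} (K : Set (EuclideanSpace ℝ (Fin m))) : ℝ := (volume K).toReal

/-- the support function of a subset of `ℝ^m` -/
def suppFn {m : ℕ} (K : Set (EuclideanSpace ℝ (Fin m))) (y : EuclideanSpace ℝ (Fin m)) : ℝ :=
  sSup ((fun z => ⟪y, z⟫) '' K)

/-- the polar body of a subset of `ℝ^m` -/
def polar {m : ℕ} (K : Set (EuclideanSpace ℝ (Fin m))) : Set (EuclideanSpace ℝ (Fin m)) :=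
  {y | ∀ z ∈ K, ⟪y, z⟫ ≤ 1}

/-- the `L_p`-centroid body `Γ_p K` of a convex body `K ⊂ ℝ^m`: the convex body whose
support function is `h(y) = ((a_{m,p} vol K)⁻¹ ∫_K |⟨y,z⟩|^p dz)^{1/p}` -/
def centroid (m : ℕ) (p : ℝ) (K : Set (EuclideanSpace ℝ (Fin m))) :
    Set (EuclideanSpace ℝ (Fin m)) :=
  {x | ∀ y, ⟪x, y⟫ ≤ ((aa m p * vol K)⁻¹ * ∫ z in K, |⟪y, z⟫| ^ p) ^ p⁻¹}

/-- the convex body `L_f = {ξ : ‖∇_ξ f‖_p ≤ 1}` in `ℝ^{n-1}` -/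
def Lbody (n : ℕ) (p : ℝ) (f : ℝ × EuclideanSpace ℝ (Fin (n - 1)) → ℝ) :
    Set (EuclideanSpace ℝ (Fin (n - 1))) :=
  {ξ | lp n p (dxi f ξ) ≤ 1}

/-- the constant `α_f = (p/(p-1)) ‖∂f/∂t‖_p^{-p} Z_p(f)^{1-n}` -/
def alpha (n : ℕ) (p : ℝ) (f : ℝ × EuclideanSpace ℝ (Fin (n - 1)) → ℝ) : ℝ :=
  p / (p - 1) * lp n p (dt f) ^ (-p) * Z n p f ^ (1 - (n : ℝ))

/-- `D_f^*(x) = ∫_{𝕊^{n-2}} ‖∇_ξ f‖_p^{1-n-p} |⟨x,ξ⟩|^p dξ` -/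
def Dstar (n : ℕ) (p : ℝ) (f : ℝ × EuclideanSpace ℝ (Fin (n - 1)) → ℝ)
    (x : EuclideanSpace ℝ (Fin (n - 1))) : ℝ :=
  ∫ ξ, lp n p (dxi f (ξ : EuclideanSpace ℝ (Fin (n - 1)))) ^ (1 - (n : ℝ) - p) *
      |⟪x, (ξ : EuclideanSpace ℝ (Fin (n - 1)))⟫| ^ p ∂(sphMeasure (n - 1))

/-- `C_f^*(t,x) = (α_f/p)|t|^p + D_f^*(x)` -/
def Cstar (n : ℕ) (p : ℝ) (f : ℝ × EuclideanSpace ℝ (Fin (n - 1)) → ℝ)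
    (y : ℝ × EuclideanSpace ℝ (Fin (n - 1))) : ℝ :=
  alpha n p f / p * |y.1| ^ p + Dstar n p f y.2

/-- `C_f`, the Legendre transform of `C_f^*` -/
def Cf (n : ℕ) (p : ℝ) (f : ℝ × EuclideanSpace ℝ (Fin (n - 1)) → ℝ) :
    ℝ × EuclideanSpace ℝ (Fin (n - 1)) → ℝ :=
  legendreP (Cstar n p f)

/-- the convex body `K_f = {y : C_f(y) ≤ 1}` in `ℝⁿ` -/
def Kf (n : ℕ) (p : ℝ) (f : ℝ × EuclideanSpace ℝ (Fin (n - 1)) → ℝ) :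
    Set (ℝ × EuclideanSpace ℝ (Fin (n - 1))) :=
  {y | Cf n p f y ≤ 1}

/-- the slice `K_{f,t} = {x : (t,x) ∈ K_f}` -/
def slice (n : ℕ) (p : ℝ) (f : ℝ × EuclideanSpace ℝ (Fin (n - 1)) → ℝ) (t : ℝ) :
    Set (EuclideanSpace ℝ (Fin (n - 1))) :=
  {x | (t, x) ∈ Kf n p f}

/-- the sharp constant `𝒦_n` of the `L²` Sobolev trace inequality -/
def Kn (n : ℕ) : ℝ :=
  1 / (Real.sqrt Real.pi * ((n : ℝ) - 2)) *
    (Real.Gamma n / (((n : ℝ) - 1) * Real.Gamma (((n : ℝ) - 1) / 2))) ^ (((n : ℝ) - 1)⁻¹)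

/-- the sharp constant `𝒜_{n,p}` of the affine `L^p` Sobolev trace inequality -/
def A (n : ℕ) (p : ℝ) : ℝ :=
  Real.pi ^ (-(p - 1) / 2) * ((p - 1) ^ ((p - 1) / p) / ((n : ℝ) - p)) ^ (p - 1) *
    (Real.Gamma n * Real.Gamma (((n : ℝ) + 1) / 2) /
      (((n : ℝ) - 1) * Real.Gamma (((n : ℝ) - 1) / p) *
        Real.Gamma (((n : ℝ) * (p - 1) + 1) / p))) ^ ((p - 1) / ((n : ℝ) - 1))


section Homogeneous

variable {E : Type*} [NormedAddCommGroup E] [NormedSpace ℝ E] [FiniteDimensional ℝ E]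

/-- A continuous function which is positive away from the origin and homogeneous of positive
degree `d` dominates a positive multiple of `‖x‖ ^ d`. -/
theorem exists_mul_norm_rpow_le {G : E → ℝ} {d : ℝ} (hd : 0 < d) (hG : Continuous G)
    (hpos : ∀ x, x ≠ 0 → 0 < G x)
    (hhom : ∀ (s : ℝ) (x : E), 0 ≤ s → G (s • x) = s ^ d * G x) :
    ∃ c, 0 < c ∧ ∀ x, c * ‖x‖ ^ d ≤ G x := by
  have hG0 : G 0 = 0 := by simpa [hd.ne'] using hhom 0 0 le_rfl
  rcases subsingleton_or_nontrivial E with hE | hE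
  · exact ⟨1, one_pos, fun x => by simp [Subsingleton.elim x 0, hG0, hd.ne']⟩
  obtain ⟨u, hu, hmin⟩ := (isCompact_sphere (0 : E) 1).exists_isMinOn
    (NormedSpace.sphere_nonempty.2 zero_le_one) hG.continuousOn
  refine ⟨G u, hpos u (ne_zero_of_mem_unit_sphere ⟨u, hu⟩), fun x => ?_⟩
  rcases eq_or_ne x 0 with rfl | hx
  · simp [hG0, hd.ne']
  have hx' : 0 < ‖x‖ := norm_pos_iff.2 hx
  have hle : G u ≤ G (‖x‖⁻¹ • x) := hmin (by simp [norm_smul, hx'.ne'])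
  calc G u * ‖x‖ ^ d ≤ G (‖x‖⁻¹ • x) * ‖x‖ ^ d := by gcongr
    _ = G (‖x‖ • ‖x‖⁻¹ • x) := by rw [hhom _ _ hx'.le, mul_comm]
    _ = G x := by rw [smul_inv_smul₀ hx'.ne']

theorem isCompact_unit_sublevel {N : E → ℝ} (hN : Continuous N)
    (hNpos : ∀ x, x ≠ 0 → 0 < N x)
    (hNhom : ∀ (s : ℝ) (x : E), 0 ≤ s → N (s • x) = s * N x) :
    IsCompact {x | N x ≤ 1} := by
  obtain ⟨c, hc, hle⟩ := exists_mul_norm_rpow_le one_pos hN hNpos (by simpa using hNhom)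
  refine (isCompact_closedBall (0 : E) c⁻¹).of_isClosed_subset
    (isClosed_le hN continuous_const) fun x hx => ?_
  have h := (hle x).trans hx
  rw [rpow_one, ← le_inv_mul_iff₀ hc, mul_one] at h
  simpa using h

/-- Integration in polar coordinates of a homogeneous function over the unit ball of a gauge. -/
theorem setIntegral_unit_sublevel_eq_integral_toSphere [Nontrivial E]
    [MeasurableSpace E] [BorelSpace E]
    (μ : Measure E) [μ.IsAddHaarMeasure] {N h : E → ℝ} {p : ℝ} (hp : 0 < p)
    (hN : Continuous N) (hNpos : ∀ x, x ≠ 0 → 0 < N x)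
    (hNhom : ∀ (s : ℝ) (x : E), 0 ≤ s → N (s • x) = s * N x)
    (hh : Continuous h) (hhom : ∀ (s : ℝ) (x : E), 0 ≤ s → h (s • x) = s ^ p * h x) :
    (Module.finrank ℝ E + p) * ∫ x in {x | N x ≤ 1}, h x ∂μ =
      ∫ ξ, N (ξ : E) ^ (-(Module.finrank ℝ E : ℝ) - p) * h ξ ∂μ.toSphere := by
  have hcomp := isCompact_unit_sublevel hN hNpos hNhom
  set m := Module.finrank ℝ E with hm
  have hm0 : 0 < m := Module.finrank_pos
  set g : E → ℝ := indicator {x | N x ≤ 1} h with hg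
  have hgint : Integrable g μ :=
    (integrable_indicator_iff hcomp.measurableSet).2 (hh.continuousOn.integrableOn_compact hcomp)
  set G : Metric.sphere (0 : E) 1 × Ioi (0 : ℝ) → ℝ := fun y => g (y.2.1 • y.1.1) with hGdef
  have hGcomp : G ∘ homeomorphUnitSphereProd E = g ∘ Subtype.val := by
    ext x
    have hx : ‖x.1‖ ≠ 0 := norm_ne_zero_iff.2 x.2
    simp [hGdef, smul_smul, hx]
  have hmp := μ.measurePreserving_homeomorphUnitSphereProd
  have hemb := (homeomorphUnitSphereProd E).measurableEmbedding
  have hGint : Integrable G (μ.toSphere.prod (.volumeIoiPow (m - 1))) := by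
    rw [← hmp.integrable_comp_emb hemb, hGcomp,
      ← integrableOn_iff_comap_subtypeVal (measurableSet_singleton _).compl]
    exact hgint.integrableOn
  have hpolar : ∫ x, g x ∂μ = ∫ y, G y ∂(μ.toSphere.prod (.volumeIoiPow (m - 1))) := by
    rw [← hmp.integral_comp hemb, show (fun x => G (homeomorphUnitSphereProd E x)) =
      fun x : ({0}ᶜ : Set E) => g x from hGcomp,
      integral_subtype_comap (measurableSet_singleton _).compl, restrict_compl_singleton]
  rw [← integral_indicator hcomp.measurableSet, hpolar, integral_prod _ hGint,
    ← integral_const_mul]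
  congr 1 with ξ
  have hNξ : 0 < N ξ := hNpos _ (ne_zero_of_mem_unit_sphere ξ)
  have hmp0 : (0 : ℝ) < m + p := by positivity
  have hradial : ∀ r ∈ Ioi (0 : ℝ), (r ^ (m - 1)).toNNReal • g (r • (ξ : E)) =
      indicator (Ioc 0 (N ξ)⁻¹) (fun r => r ^ ((m : ℝ) + p - 1) * h ξ) r := by
    intro r hr
    have hr0 : 0 < r := hr
    have hmem : r • (ξ : E) ∈ {x | N x ≤ 1} ↔ r ∈ Ioc 0 (N ξ)⁻¹ := by
      rw [mem_ofPred_eq, hNhom _ _ hr0.le, mem_Ioc, ← le_div_iff₀ hNξ, one_div]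
      simp [hr0]
    rw [NNReal.smul_def, Real.coe_toNNReal _ (by positivity), hg]
    by_cases hrm : r ∈ Ioc 0 (N ξ)⁻¹
    · rw [indicator_of_mem hrm, indicator_of_mem (hmem.2 hrm), hhom _ _ hr0.le, smul_eq_mul,
        ← mul_assoc, ← rpow_natCast, ← rpow_add hr0, Nat.cast_sub hm0, Nat.cast_one]
      ring_nf
    · rw [indicator_of_notMem hrm, indicator_of_notMem (mt hmem.1 hrm), smul_zero]
  have hinner : ∫ r, G (ξ, r) ∂(.volumeIoiPow (m - 1)) =
      (N ξ)⁻¹ ^ ((m : ℝ) + p) / (m + p) * h ξ := by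
    simp only [Measure.volumeIoiPow, ENNReal.ofReal, hGdef]
    rw [integral_withDensity_eq_integral_smul
        (measurable_subtype_coe.pow_const _).real_toNNReal,
      integral_subtype_comap measurableSet_Ioi
        fun r : ℝ => (r ^ (m - 1)).toNNReal • g (r • (ξ : E)),
      setIntegral_congr_fun measurableSet_Ioi hradial,
      setIntegral_indicator measurableSet_Ioc,
      inter_eq_right.2 Ioc_subset_Ioi_self, integral_mul_const,
      ← intervalIntegral.integral_of_le (by positivity), integral_rpow (by left; linarith)]
    simp [hmp0.ne']
  rw [hinner, inv_rpow hNξ.le, ← rpow_neg hNξ.le, neg_add']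
  field_simp

end Homogeneous

section Scalar

variable {V : Type*} [NormedAddCommGroup V] [InnerProductSpace ℝ V]

/-- The unit sublevel set of the Legendre transform of a `p`-homogeneous function `D`, in terms
of the `p`-th root of `D`. -/
theorem forall_inner_sub_le_one_iff {D : V → ℝ} {p q : ℝ} (hpq : p.HolderConjugate q)
    (hpos : ∀ z, z ≠ 0 → 0 < D z)
    (hhom : ∀ (s : ℝ) (z : V), 0 ≤ s → D (s • z) = s ^ p * D z) (x : V) :
    (∀ z, ⟪x, z⟫ - D z ≤ 1) ↔ ∀ z, ⟪x, z⟫ ≤ q ^ q⁻¹ * p ^ p⁻¹ * D z ^ p⁻¹ := by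
  have hp0 : 0 < p := hpq.pos
  have hq0 : 0 < q := hpq.symm.pos
  have hD0 : D 0 = 0 := by simpa [hp0.ne'] using hhom 0 0 le_rfl
  have hpi : 0 < p⁻¹ := by positivity
  constructor
  · intro h z
    rcases eq_or_ne z 0 with rfl | hz
    · simp [hD0, hpi.ne']
    have hDz := hpos z hz
    set s := (q / p) ^ p⁻¹ * (D z ^ p⁻¹)⁻¹ with hs
    have hs0 : 0 < s := by positivity
    have hsp : s ^ p * D z = q / p := by
      rw [hs, mul_rpow (by positivity) (by positivity), inv_rpow (by positivity),
        rpow_inv_rpow (by positivity) hp0.ne', rpow_inv_rpow hDz.le hp0.ne']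
      field_simp
    have hone : q / p + 1 = q := by
      have := hpq.inv_add_inv_eq_one
      field_simp at this ⊢
      linarith
    have hsx := h (s • z)
    rw [inner_smul_right, hhom _ _ hs0.le, hsp] at hsx
    have hle : ⟪x, z⟫ ≤ q / s := by
      rw [le_div_iff₀ hs0]
      linarith
    refine hle.trans_eq ?_
    have hqq : q ^ q⁻¹ * q ^ p⁻¹ = q := by
      rw [← rpow_add hq0, add_comm, hpq.inv_add_inv_eq_one, rpow_one]
    rw [hs, div_rpow hq0.le hp0.le]
    nth_rewrite 1 [← hqq]
    field_simp
  · intro h z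
    have hDz : 0 ≤ D z := by
      rcases eq_or_ne z 0 with rfl | hz
      · exact hD0.ge
      · exact (hpos z hz).le
    have hy := Real.young_inequality_of_nonneg (a := (p * D z) ^ p⁻¹) (b := q ^ q⁻¹)
      (by positivity) (by positivity) hpq
    rw [rpow_inv_rpow (by positivity) hp0.ne', rpow_inv_rpow hq0.le hq0.ne',
      mul_div_cancel_left₀ _ hp0.ne', div_self hq0.ne', mul_rpow hp0.le hDz] at hy
    linarith [h z]

/-- A function dominating a power of the norm with exponent larger than one has a finite Legendre
transform. -/
theorem bddAbove_range_inner_sub {D : V → ℝ} {c p q : ℝ} (hpq : p.HolderConjugate q)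
    (hc : 0 < c) (hD : ∀ z, c * ‖z‖ ^ p ≤ D z) (x : V) :
    BddAbove (range fun z => ⟪x, z⟫ - D z) := by
  have hp0 : 0 < p := hpq.pos
  have hq0 : 0 < q := hpq.symm.pos
  set a := (p * c) ^ p⁻¹ with ha
  have ha0 : 0 < a := by positivity
  refine ⟨(‖x‖ / a) ^ q / q, ?_⟩
  rintro _ ⟨z, rfl⟩
  have hy := Real.young_inequality_of_nonneg (a := a * ‖z‖) (b := ‖x‖ / a)
    (by positivity) (by positivity) hpq
  have hap : (a * ‖z‖) ^ p / p = c * ‖z‖ ^ p := by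
    rw [mul_rpow ha0.le (norm_nonneg _), ha, rpow_inv_rpow (by positivity) hp0.ne']
    field_simp
  have hprod : a * ‖z‖ * (‖x‖ / a) = ‖x‖ * ‖z‖ := by field_simp
  rw [hap, hprod] at hy
  have := real_inner_le_norm x z
  have := hD z
  simp only
  linarith

end Scalar

theorem w_pos {s : ℝ} (hs : 0 ≤ s) : 0 < w s :=
  div_pos (by positivity) (Gamma_pos_of_pos (by positivity))

theorem aa_pos (m : ℕ) {p : ℝ} (hp : 1 < p) : 0 < aa m p :=
  div_pos (w_pos (by positivity))
    (mul_pos (mul_pos (w_pos (by norm_num)) (w_pos (by positivity))) (w_pos (by linarith)))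

section Gauge

variable {n : ℕ} {p : ℝ} {f : ℝ × EuclideanSpace ℝ (Fin (n - 1)) → ℝ}

theorem isOpen_H (n : ℕ) : IsOpen (H n) := isOpen_lt continuous_const continuous_fst

theorem continuous_abs_dxi_rpow (hp : 0 < p) (hf : ContDiff ℝ (⊤ : ℕ∞) f) :
    Continuous fun y : EuclideanSpace ℝ (Fin (n - 1)) × (ℝ × EuclideanSpace ℝ (Fin (n - 1))) =>
      |dxi f y.1 y.2| ^ p := by
  have hdf : Continuous (fderiv ℝ f) := hf.continuous_fderiv (by simp)
  have h : Continuous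
      fun y : EuclideanSpace ℝ (Fin (n - 1)) × (ℝ × EuclideanSpace ℝ (Fin (n - 1))) =>
        fderiv ℝ f y.2 ((0 : ℝ), y.1) :=
    (hdf.comp continuous_snd).clm_apply (continuous_const.prodMk continuous_fst)
  exact h.abs.rpow_const fun _ => Or.inr hp.le

theorem dxi_eq_zero_of_notMem_tsupport {ξ : EuclideanSpace ℝ (Fin (n - 1))}
    {y : ℝ × EuclideanSpace ℝ (Fin (n - 1))} (hy : y ∉ tsupport f) : dxi f ξ y = 0 := by
  have : fderiv ℝ f y = 0 := by
    by_contra h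
    exact hy (support_fderiv_subset ℝ h)
  simp [dxi, this]

theorem lp_nonneg (g : ℝ × EuclideanSpace ℝ (Fin (n - 1)) → ℝ) : 0 ≤ lp n p g :=
  rpow_nonneg (integral_nonneg fun _ => by positivity) _

theorem continuous_lp_dxi (hp : 0 < p) (hf : ContDiff ℝ (⊤ : ℕ∞) f) (hfc : HasCompactSupport f) :
    Continuous fun ξ => lp n p (dxi f ξ) := by
  refine Continuous.rpow_const ?_ fun _ => Or.inr (by positivity)
  rw [← continuousOn_univ]
  refine continuousOn_integral_of_compact_support hfc
    (continuous_abs_dxi_rpow hp hf).continuousOn fun ξ y _ hy => ?_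
  rw [dxi_eq_zero_of_notMem_tsupport hy, abs_zero, zero_rpow hp.ne']

theorem lp_dxi_smul (hp : 0 < p) {s : ℝ} (hs : 0 ≤ s) (ξ : EuclideanSpace ℝ (Fin (n - 1))) :
    lp n p (dxi f (s • ξ)) = s * lp n p (dxi f ξ) := by
  have h : ∀ y, |dxi f (s • ξ) y| ^ p = s ^ p * |dxi f ξ y| ^ p := fun y => by
    have : ((0 : ℝ), s • ξ) = s • ((0 : ℝ), ξ) := by simp
    rw [dxi, this, map_smul, smul_eq_mul, abs_mul, abs_of_nonneg hs,
      mul_rpow hs (abs_nonneg _), dxi]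
  simp only [lp, h]
  rw [integral_const_mul, mul_rpow (by positivity) (integral_nonneg fun _ => by positivity),
    rpow_rpow_inv hs hp.ne']

/-- A compactly supported function whose derivative in a fixed nonzero tangential direction
vanishes on the half-space vanishes there. -/
theorem eq_zero_on_H_of_dxi_eq_zero (hf : ContDiff ℝ (⊤ : ℕ∞) f) (hfc : HasCompactSupport f)
    {ξ : EuclideanSpace ℝ (Fin (n - 1))} (hξ : ξ ≠ 0) (h : ∀ y ∈ H n, dxi f ξ y = 0) :
    ∀ y ∈ H n, f y = 0 := by
  intro y hy
  have hderiv : ∀ s : ℝ, HasDerivAt (fun s : ℝ => f (y + s • ((0 : ℝ), ξ))) 0 s := fun s => by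
    have hline : HasDerivAt (fun s : ℝ => y + s • ((0 : ℝ), ξ)) ((0 : ℝ), ξ) s := by
      simpa using ((hasDerivAt_id s).smul_const ((0 : ℝ), ξ)).const_add y
    have hcomp := ((hf.differentiable (by simp)) (y + s • ((0 : ℝ), ξ))).hasFDerivAt.comp_hasDerivAt
      s hline
    have hmem : y + s • ((0 : ℝ), ξ) ∈ H n := by simpa [H] using hy
    have h0 : fderiv ℝ f (y + s • ((0 : ℝ), ξ)) ((0 : ℝ), ξ) = 0 := h _ hmem
    rwa [h0] at hcomp
  have hconst : ∀ s : ℝ, f (y + s • ((0 : ℝ), ξ)) = f y := fun s => by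
    simpa using is_const_of_deriv_eq_zero (fun s => (hderiv s).differentiableAt)
      (fun s => (hderiv s).deriv) s 0
  by_contra hfy
  have hξ' : 0 < ‖((0 : ℝ), ξ)‖ := norm_pos_iff.2 (by simpa using hξ)
  obtain ⟨R, hR⟩ := hfc.isCompact.isBounded.exists_norm_le
  have hmem := hR _ (subset_tsupport f
    (show f (y + ((R + ‖y‖ + 1) / ‖((0 : ℝ), ξ)‖) • ((0 : ℝ), ξ)) ≠ 0 by rwa [hconst]))
  have hR0 : 0 ≤ R := (norm_nonneg _).trans hmem
  have htri := norm_sub_le (y + ((R + ‖y‖ + 1) / ‖((0 : ℝ), ξ)‖) • ((0 : ℝ), ξ)) y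
  rw [add_sub_cancel_left, norm_smul, Real.norm_of_nonneg (by positivity),
    div_mul_cancel₀ _ hξ'.ne'] at htri
  linarith

theorem lp_dxi_pos (hp : 0 < p) (hf : ContDiff ℝ (⊤ : ℕ∞) f) (hfc : HasCompactSupport f)
    (hf0 : ∃ y ∈ H n, f y ≠ 0) {ξ : EuclideanSpace ℝ (Fin (n - 1))} (hξ : ξ ≠ 0) :
    0 < lp n p (dxi f ξ) := by
  have hcont : Continuous fun y => |dxi f ξ y| ^ p :=
    (continuous_abs_dxi_rpow hp hf).comp (continuous_const.prodMk continuous_id)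
  have hint : Integrable (fun y => |dxi f ξ y| ^ p) (volume.restrict (H n)) :=
    (hcont.integrable_of_hasCompactSupport (hfc.mono' fun y hy => by
      by_contra h
      simp [dxi_eq_zero_of_notMem_tsupport h, hp.ne'] at hy)).restrict
  have hnn : 0 ≤ fun y => |dxi f ξ y| ^ p := fun y => by positivity
  refine rpow_pos_of_pos ((integral_nonneg hnn).lt_of_ne fun h0 => ?_) _
  obtain ⟨y, hy, hfy⟩ := hf0
  refine hfy (eq_zero_on_H_of_dxi_eq_zero hf hfc hξ (fun z hz => ?_) y hy)
  have hae := (integral_eq_zero_iff_of_nonneg hnn hint).1 h0.symm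
  have hz0 : |dxi f ξ z| ^ p = 0 :=
    Measure.eqOn_open_of_ae_eq hae (isOpen_H n) hcont.continuousOn continuousOn_const hz
  simpa using (rpow_eq_zero (abs_nonneg _) hp.ne').1 hz0

theorem alpha_nonneg (hp : 1 < p) : 0 ≤ alpha n p f := by
  have hZ : 0 ≤ Z n p f :=
    rpow_nonneg (integral_nonneg fun _ => rpow_nonneg (lp_nonneg _) _) _
  have h1 : 0 ≤ p - 1 := by linarith
  have := lp_nonneg (n := n) (p := p) (dt f)
  unfold alpha
  positivity

/-- If `D_f^*` is coercive then the central slice of `K_f` is the unit sublevel set of the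
Legendre transform of `D_f^*`. -/
theorem mem_slice_zero_iff {c q : ℝ} (hpq : p.HolderConjugate q) (hc : 0 < c)
    (hD : ∀ z, c * ‖z‖ ^ p ≤ Dstar n p f z) (x : EuclideanSpace ℝ (Fin (n - 1))) :
    x ∈ slice n p f 0 ↔ ∀ z, ⟪x, z⟫ - Dstar n p f z ≤ 1 := by
  have hα : ∀ z : ℝ × EuclideanSpace ℝ (Fin (n - 1)),
      pairP (0, x) z - Cstar n p f z ≤ ⟪x, z.2⟫ - Dstar n p f z.2 := fun z => by
    have h : 0 ≤ alpha n p f / p * |z.1| ^ p :=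
      mul_nonneg (div_nonneg (alpha_nonneg hpq.lt) hpq.pos.le) (by positivity)
    simp only [pairP, Cstar]
    linarith
  have hbdd : BddAbove (range fun z => pairP (0, x) z - Cstar n p f z) := by
    obtain ⟨M, hM⟩ := bddAbove_range_inner_sub hpq hc hD x
    exact ⟨M, by rintro _ ⟨z, rfl⟩; exact (hα z).trans (hM ⟨z.2, rfl⟩)⟩
  change (⨆ z, (pairP (0, x) z - Cstar n p f z)) ≤ 1 ↔ _
  rw [ciSup_le_iff hbdd]
  refine ⟨fun h z => ?_, fun h z => (hα z).trans (h z.2)⟩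
  simpa [pairP, Cstar, hpq.pos.ne'] using h (0, z)

end Gauge

/-- The `p`-th moment function of a compact set with nonempty interior is positive away from the
origin. -/
theorem setIntegral_abs_inner_rpow_pos {m : ℕ} {p : ℝ} (hp : 0 < p)
    {L U : Set (EuclideanSpace ℝ (Fin m))} (hL : IsCompact L) (hU : IsOpen U) (hUL : U ⊆ L)
    (h0 : 0 ∈ U) {x : EuclideanSpace ℝ (Fin m)} (hx : x ≠ 0) :
    0 < ∫ z in L, |⟪x, z⟫| ^ p := by
  have hcont : Continuous fun z : EuclideanSpace ℝ (Fin m) => |⟪x, z⟫| ^ p :=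
    (continuous_const.inner continuous_id).abs.rpow_const fun _ => Or.inr hp.le
  have hnn : 0 ≤ fun z : EuclideanSpace ℝ (Fin m) => |⟪x, z⟫| ^ p := fun z => by positivity
  refine (integral_nonneg hnn).lt_of_ne fun hzero => ?_
  have hae := (integral_eq_zero_iff_of_nonneg hnn
    (hcont.continuousOn.integrableOn_compact hL)).1 hzero.symm
  have heq := Measure.eqOn_open_of_ae_eq (ae_restrict_of_ae_restrict_of_subset hUL hae) hU
    hcont.continuousOn continuousOn_const
  have hlim : Filter.Tendsto (fun s : ℝ => s • x) (nhdsWithin 0 (Ioi 0)) (nhds 0) := by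
    have : Continuous fun s : ℝ => s • x := by fun_prop
    simpa using (this.tendsto 0).mono_left nhdsWithin_le_nhds
  obtain ⟨s, hsU, hs⟩ := ((hlim.eventually (hU.mem_nhds h0)).and
    (eventually_mem_nhdsWithin)).exists
  have hs0 : (0 : ℝ) < s := hs
  have h : |⟪x, s • x⟫| ^ p = 0 := heq hsU
  have h' := (rpow_eq_zero (abs_nonneg _) hp.ne').1 h
  rw [abs_eq_zero, inner_smul_right, mul_eq_zero, inner_self_eq_zero] at h'
  exact h'.elim hs0.ne' hx

theorem mem_smul_centroid_iff {m : ℕ} {p lam : ℝ} (hlam : 0 < lam)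
    (K : Set (EuclideanSpace ℝ (Fin m))) (x : EuclideanSpace ℝ (Fin m)) :
    x ∈ lam • centroid m p K ↔
      ∀ y, ⟪x, y⟫ ≤ lam * ((aa m p * vol K)⁻¹ * ∫ z in K, |⟪y, z⟫| ^ p) ^ p⁻¹ := by
  rw [mem_smul_set_iff_inv_smul_mem₀ hlam.ne']
  refine forall_congr' fun y => ?_
  rw [real_inner_smul_left, inv_mul_le_iff₀ hlam]

/-- The central slice `K_{f,0}` of `K_f` is a dilate of the `L_p`-centroid body of `L_f`:
`K_{f,0} = ((n+p-1) a_{n-1,p} vol(L_f))^{1/p} q^{1/q} p^{1/p} Γ_p L_f`, and consequently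
`vol(K_{f,0}) = (p q^{p/q} (n+p-1) a_{n-1,p})^{(n-1)/p} vol(L_f)^{(n-1)/p} vol(Γ_p L_f)`. -/
theorem central_slice_eq_dilated_centroid_body (n : ℕ) (hn : 3 ≤ n) (p q : ℝ) (hp : 1 < p)
    (hpn : p < n) (hq : q = p / (p - 1))
    (f : ℝ × EuclideanSpace ℝ (Fin (n - 1)) → ℝ) (hf : ContDiff ℝ (⊤ : ℕ∞) f)
    (hfc : HasCompactSupport f) (hf0 : ∃ y ∈ H n, f y ≠ 0) :
    slice n p f 0 =
      ((((n : ℝ) + p - 1) * aa (n - 1) p * vol (Lbody n p f)) ^ p⁻¹ * q ^ q⁻¹ * p ^ p⁻¹) •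
        centroid (n - 1) p (Lbody n p f) ∧
    vol (slice n p f 0) =
      (p * q ^ (p / q) * ((n : ℝ) + p - 1) * aa (n - 1) p) ^ (((n : ℝ) - 1) / p) *
        vol (Lbody n p f) ^ (((n : ℝ) - 1) / p) *
        vol (centroid (n - 1) p (Lbody n p f)) := by
  have hp0 : 0 < p := by linarith
  have hpq : p.HolderConjugate q := hq ▸ Real.HolderConjugate.conjExponent hp
  have hq0 : 0 < q := hpq.symm.pos
  have hcast : ((n - 1 : ℕ) : ℝ) = (n : ℝ) - 1 := by
    rw [Nat.cast_sub (by omega), Nat.cast_one]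
  have : Nonempty (Fin (n - 1)) := ⟨⟨0, by omega⟩⟩
  have hfin : Module.finrank ℝ (EuclideanSpace ℝ (Fin (n - 1))) = n - 1 := by simp
  have hNcont := continuous_lp_dxi hp0 hf hfc
  have hNpos : ∀ ξ, ξ ≠ 0 → 0 < lp n p (dxi f ξ) := fun ξ => lp_dxi_pos hp0 hf hfc hf0
  have hNhom : ∀ (s : ℝ) ξ, 0 ≤ s → lp n p (dxi f (s • ξ)) = s * lp n p (dxi f ξ) :=
    fun s ξ hs => lp_dxi_smul hp0 hs ξ
  have hLcomp : IsCompact (Lbody n p f) := isCompact_unit_sublevel hNcont hNpos hNhom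
  set U : Set (EuclideanSpace ℝ (Fin (n - 1))) := {ξ | lp n p (dxi f ξ) < 1} with hUdef
  have hU : IsOpen U := isOpen_lt hNcont continuous_const
  have hUL : U ⊆ Lbody n p f := fun ξ (hξ : lp n p (dxi f ξ) < 1) => hξ.le
  have hU0 : (0 : EuclideanSpace ℝ (Fin (n - 1))) ∈ U := by
    have h := hNhom 0 0 le_rfl
    rw [smul_zero, zero_mul] at h
    rw [hUdef, mem_ofPred_eq, h]
    exact one_pos
  have hvol : 0 < vol (Lbody n p f) :=
    ENNReal.toReal_pos ((hU.measure_pos volume ⟨0, hU0⟩).trans_le (measure_mono hUL)).ne'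
      hLcomp.measure_ne_top
  have haa := aa_pos (n - 1) hp
  have hnp : 0 < (n : ℝ) + p - 1 := by
    have : (3 : ℝ) ≤ n := by exact_mod_cast hn
    linarith
  have hDstar : ∀ x, Dstar n p f x =
      ((n : ℝ) + p - 1) * ∫ z in Lbody n p f, |⟪x, z⟫| ^ p := fun x => by
    have h := setIntegral_unit_sublevel_eq_integral_toSphere volume hp0 hNcont hNpos hNhom
      (h := fun z => |⟪x, z⟫| ^ p)
      ((continuous_const.inner continuous_id).abs.rpow_const fun _ => Or.inr hp0.le)
      fun s z hs => by
        rw [inner_smul_right, abs_mul, abs_of_nonneg hs, mul_rpow hs (abs_nonneg _)]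
    rw [hfin, hcast, show (n : ℝ) - 1 + p = (n : ℝ) + p - 1 by ring,
      show -((n : ℝ) - 1) - p = 1 - (n : ℝ) - p by ring] at h
    exact h.symm
  have hDpos : ∀ x, x ≠ 0 → 0 < Dstar n p f x := fun x hx => by
    rw [hDstar]
    exact mul_pos hnp (setIntegral_abs_inner_rpow_pos hp0 hLcomp hU hUL hU0 hx)
  have hDhom : ∀ (s : ℝ) x, 0 ≤ s → Dstar n p f (s • x) = s ^ p * Dstar n p f x :=
    fun s x hs => by
      simp only [hDstar, real_inner_smul_left, abs_mul, abs_of_nonneg hs,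
        mul_rpow hs (abs_nonneg _)]
      rw [integral_const_mul]
      ring
  have hDcont : Continuous (Dstar n p f) := by
    rw [funext hDstar]
    refine continuous_const.mul (continuous_parametric_integral_of_continuous ?_ hLcomp)
    exact (continuous_fst.inner continuous_snd).abs.rpow_const fun _ => Or.inr hp0.le
  obtain ⟨c, hc, hDle⟩ := exists_mul_norm_rpow_le hp0 hDcont hDpos hDhom
  set b : ℝ := ((n : ℝ) + p - 1) * aa (n - 1) p * vol (Lbody n p f) with hb
  have hb0 : 0 < b := by positivity
  set lam : ℝ := b ^ p⁻¹ * q ^ q⁻¹ * p ^ p⁻¹ with hlam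
  have hlam0 : 0 < lam := by positivity
  have hslice : slice n p f 0 = lam • centroid (n - 1) p (Lbody n p f) := by
    ext x
    rw [mem_slice_zero_iff hpq hc hDle, forall_inner_sub_le_one_iff hpq hDpos hDhom,
      mem_smul_centroid_iff hlam0]
    refine forall_congr' fun y => ?_
    have hI : 0 ≤ ∫ z in Lbody n p f, |⟪y, z⟫| ^ p := integral_nonneg fun _ => by positivity
    have hroot : Dstar n p f y ^ p⁻¹ = b ^ p⁻¹ *
        ((aa (n - 1) p * vol (Lbody n p f))⁻¹ * ∫ z in Lbody n p f, |⟪y, z⟫| ^ p) ^ p⁻¹ := by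
      rw [← mul_rpow hb0.le (by positivity), hDstar, hb]
      congr 1
      field_simp
    rw [hroot, hlam]
    ring_nf
  refine ⟨hslice, ?_⟩
  rw [hslice, vol, Measure.addHaar_smul_of_nonneg _ hlam0.le, ENNReal.toReal_mul,
    ENNReal.toReal_ofReal (by positivity), hfin, ← vol]
  congr 1
  have hroot : (p * q ^ (p / q) * b) ^ p⁻¹ = lam := by
    rw [mul_rpow (by positivity) hb0.le, mul_rpow hp0.le (by positivity), ← rpow_mul hq0.le,
      div_mul_comm, mul_comm _ p, ← mul_div_assoc, mul_inv_cancel₀ hp0.ne', one_div, hlam]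
    ring
  rw [← mul_rpow (by positivity) hvol.le,
    show p * q ^ (p / q) * ((n : ℝ) + p - 1) * aa (n - 1) p * vol (Lbody n p f) =
      p * q ^ (p / q) * b by rw [hb]; ring,
    div_eq_inv_mul ((n : ℝ) - 1), rpow_mul (by positivity), hroot, ← hcast, rpow_natCast]

end AffineTrace
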